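/- Let P be a general user program. Then GenDisj(P) is a strong conservative extension of P. -/

import Mathlib

namespace ASP

/-- Propositional formulas over atoms `α`, built with ∧, ∨, ← and ⊥.
`impl A B` denotes the formula `B ← A` (i.e. `A → B`). -/
inductive PropForm (α : Type) : Type
  | var : α → PropForm α
  | fals : PropForm α
  | conj : PropForm α → PropForm α → PropForm α
  | disj : PropForm α → PropForm α → PropForm α
  | impl : PropForm α → PropForm α → PropForm α
  deriving DecidableEq

namespace PropForm

variable {α : Type}

/-- `¬F` abbreviates `⊥ ← F`. -/
def neg (A : PropForm α) : PropForm α := impl A fals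

/-- `⊤` abbreviates `⊥ ← ⊥`. -/
def top : PropForm α := impl fals fals

/-- The set of atoms occurring in a formula. -/
def atoms : PropForm α → Set α
  | var a => {a}
  | fals => ∅
  | conj A B => atoms A ∪ atoms B
  | disj A B => atoms A ∪ atoms B
  | impl A B => atoms A ∪ atoms B

end PropForm

open PropForm

/-- Hilbert-style derivability for intuitionistic propositional logic,
with an extra set `Ax` of additional axioms. -/
inductive Deriv {α : Type} (Ax : Set (PropForm α)) : PropForm α → Prop
  | ax {A} : A ∈ Ax → Deriv Ax A
  | k (A B) : Deriv Ax (impl A (impl B A))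
  | s (A B C) : Deriv Ax (impl (impl A (impl B C)) (impl (impl A B) (impl A C)))
  | conjIntro (A B) : Deriv Ax (impl A (impl B (conj A B)))
  | conjElimL (A B) : Deriv Ax (impl (conj A B) A)
  | conjElimR (A B) : Deriv Ax (impl (conj A B) B)
  | disjIntroL (A B) : Deriv Ax (impl A (disj A B))
  | disjIntroR (A B) : Deriv Ax (impl B (disj A B))
  | disjElim (A B C) : Deriv Ax (impl (impl A C) (impl (impl B C) (impl (disj A B) C)))
  | falsElim (A) : Deriv Ax (impl fals A)
  | mp {A B} : Deriv Ax (impl A B) → Deriv Ax A → Deriv Ax B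

/-- `F` is a theorem of intuitionistic propositional logic. -/
def IThm {α : Type} (F : PropForm α) : Prop := Deriv ∅ F

/-- `F` is a theorem of classical propositional logic
(intuitionistic logic plus double-negation elimination). -/
def CThm {α : Type} (F : PropForm α) : Prop :=
  Deriv {F | ∃ A, F = impl (neg (neg A)) A} F

/-- Conjunction of a finite list of formulas (empty conjunction is ⊤). -/
def bigConj {α : Type} : List (PropForm α) → PropForm α
  | [] => top
  | [A] => A
  | A :: L => conj A (bigConj L)

/-- Disjunction of a finite list of formulas (empty disjunction is ⊥). -/
def bigDisj {α : Type} : List (PropForm α) → PropForm α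
  | [] => fals
  | [A] => A
  | A :: L => disj A (bigDisj L)

/-- `T ⊢_X F`: the formula `F ← (F₁ ∧ ... ∧ Fₙ)` is a theorem of the logic
whose theorems are `Thm`, for some `F₁, ..., Fₙ ∈ T`. -/
def ProvesFrom {α : Type} (Thm : PropForm α → Prop) (T : Set (PropForm α))
    (F : PropForm α) : Prop :=
  ∃ L : List (PropForm α), (∀ G ∈ L, G ∈ T) ∧ Thm (impl (bigConj L) F)

/-- `T ⊢_I F`. -/
def IProves {α : Type} (T : Set (PropForm α)) (F : PropForm α) : Prop :=
  ProvesFrom IThm T F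

/-- `T ⊢_C F`. -/
def CProves {α : Type} (T : Set (PropForm α)) (F : PropForm α) : Prop :=
  ProvesFrom CThm T F

/-- `T` is consistent in intuitionistic logic. -/
def IConsistent {α : Type} (T : Set (PropForm α)) : Prop := ¬ IProves T fals

/-- `T ⊩_I M`: `T` is consistent and proves (intuitionistically) every atom of `M`. -/
def IProvesAll {α : Type} (T : Set (PropForm α)) (M : Set α) : Prop :=
  IConsistent T ∧ ∀ a ∈ M, IProves T (var a)

/-- `T ≡_I U`: the two theories prove each other's formulas intuitionistically. -/
def IEquivTh {α : Type} (T U : Set (PropForm α)) : Prop :=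
  (∀ F ∈ U, IProves T F) ∧ (∀ F ∈ T, IProves U F)

/-- The signature (set of occurring atoms) of a theory. -/
def sigTh {α : Type} (T : Set (PropForm α)) : Set α := ⋃ F ∈ T, F.atoms

/-- `T` is (literal) complete: for every atom `a` of its signature,
`T ⊢_I a` or `T ⊢_I ¬a`. -/
def IComplete {α : Type} (T : Set (PropForm α)) : Prop :=
  ∀ a ∈ sigTh T, IProves T (var a) ∨ IProves T (neg (var a))

/-- `{¬a : a ∈ S}`. -/
def negSet {α : Type} (S : Set α) : Set (PropForm α) := (fun a => neg (var a)) '' S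

/-- `{¬¬a : a ∈ S}`. -/
def negnegSet {α : Type} (S : Set α) : Set (PropForm α) :=
  (fun a => neg (neg (var a))) '' S

/-- Classical two-valued satisfaction, identifying an interpretation with the
set of atoms it makes true. -/
def sat2 {α : Type} (X : Set α) : PropForm α → Prop
  | .var a => a ∈ X
  | .fals => False
  | .conj A B => sat2 X A ∧ sat2 X B
  | .disj A B => sat2 X A ∨ sat2 X B
  | .impl A B => sat2 X A → sat2 X B

/-- `X` is a classical model of the theory `T`. -/
def isModel2 {α : Type} (X : Set α) (T : Set (PropForm α)) : Prop := ∀ F ∈ T, sat2 X F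

/-- `M` is a minimal (under ⊆) classical model of `T`. -/
def isMinModel {α : Type} (T : Set (PropForm α)) (M : Set α) : Prop :=
  isModel2 M T ∧ ∀ N ⊆ M, isModel2 N T → N = M

/-- Evaluation in the 3-valued Gödel logic G3. -/
def g3 {α : Type} (I : α → Fin 3) : PropForm α → Fin 3
  | .var a => I a
  | .fals => 0
  | .conj A B => min (g3 I A) (g3 I B)
  | .disj A B => max (g3 I A) (g3 I B)
  | .impl A B => if g3 I A ≤ g3 I B then 2 else g3 I B

/-- Nested formulas: built from atoms, ⊤ and ⊥ using ∧, ∨ and ¬. -/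
inductive NF (α : Type) : Type
  | var : α → NF α
  | top : NF α
  | bot : NF α
  | conj : NF α → NF α → NF α
  | disj : NF α → NF α → NF α
  | neg : NF α → NF α
  deriving DecidableEq

namespace NF

variable {α : Type}

/-- Reading a nested formula as a propositional formula
(`⊤ = ⊥ ← ⊥` and `¬F = ⊥ ← F`). -/
def toProp : NF α → PropForm α
  | var a => .var a
  | top => PropForm.top
  | bot => .fals
  | conj A B => .conj (toProp A) (toProp B)
  | disj A B => .disj (toProp A) (toProp B)
  | neg A => PropForm.neg (toProp A)

/-- Atoms occurring in a nested formula. -/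
def atoms : NF α → Set α
  | var a => {a}
  | top => ∅
  | bot => ∅
  | conj A B => atoms A ∪ atoms B
  | disj A B => atoms A ∪ atoms B
  | neg A => atoms A

/-- Satisfaction of a (basic, negation-free) nested formula by a set of atoms. -/
def satB (X : Set α) : NF α → Prop
  | var a => a ∈ X
  | top => True
  | bot => False
  | conj A B => satB X A ∧ satB X B
  | disj A B => satB X A ∨ satB X B
  | neg A => ¬ satB X A

open scoped Classical in
/-- The reduct `F^X`: each maximal subformula `¬G` is replaced by ⊥ if
`X ⊨ G^X` and by ⊤ otherwise. -/
noncomputable def reduct (X : Set α) : NF α → NF α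
  | var a => var a
  | top => top
  | bot => bot
  | conj A B => conj (reduct X A) (reduct X B)
  | disj A B => disj (reduct X A) (reduct X B)
  | neg A => if satB X (reduct X A) then bot else top

end NF

/-- An augmented clause `H ← B` is a pair `(H, B)` of nested formulas. -/
abbrev AugClause (α : Type) := NF α × NF α

/-- The propositional formula `H ← B` of an augmented clause. -/
def clauseToProp {α : Type} (c : AugClause α) : PropForm α :=
  .impl c.2.toProp c.1.toProp

/-- The theory of an augmented program. -/
def progTh {α : Type} (P : List (AugClause α)) : Set (PropForm α) :=
  {F | ∃ c ∈ P, clauseToProp c = F}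

/-- The signature of an augmented program. -/
def progSig {α : Type} (P : List (AugClause α)) : Set α :=
  {a | ∃ c ∈ P, a ∈ c.1.atoms ∪ c.2.atoms}

/-- `X` is closed under the (basic) program `P`: for each clause `H ← B`,
`X ⊨ H` whenever `X ⊨ B`. -/
def closedUnder {α : Type} (X : Set α) (P : List (AugClause α)) : Prop :=
  ∀ c ∈ P, NF.satB X c.2 → NF.satB X c.1

/-- The reduct `P^X` of an augmented program. -/
noncomputable def progReduct {α : Type} (X : Set α) (P : List (AugClause α)) :
    List (AugClause α) :=
  P.map fun c => (c.1.reduct X, c.2.reduct X)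

/-- `M` is an answer set of `P`: `M` is minimal (under ⊆) among the sets of
atoms closed under the reduct `P^M`. -/
def isAnswerSet {α : Type} (P : List (AugClause α)) (M : Set α) : Prop :=
  closedUnder M (progReduct M P) ∧ ∀ N ⊆ M, closedUnder N (progReduct M P) → N = M

/-- `M` is a min-answer set of `P`: both an answer set and a minimal model. -/
def isMinAnswerSet {α : Type} (P : List (AugClause α)) (M : Set α) : Prop :=
  isAnswerSet P M ∧ isMinModel (progTh P) M

/-- A G3 interpretation models an augmented program. -/
def g3ModelsProg {α : Type} (I : α → Fin 3) (P : List (AugClause α)) : Prop :=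
  ∀ c ∈ P, g3 I (clauseToProp c) = 2

/-- A free clause: a list of head literals and a list of body literals,
a literal being an atom `(a, true)` or a negated atom `(a, false)`.
It denotes `h₁ ∨ ... ∨ hₙ ← b₁ ∧ ... ∧ bₘ` (empty head = ⊥, empty body = ⊤). -/
structure FClause (α : Type) where
  head : List (α × Bool)
  body : List (α × Bool)
  deriving DecidableEq

/-- The propositional formula of a literal. -/
def litToProp {α : Type} : α × Bool → PropForm α
  | (a, true) => .var a
  | (a, false) => PropForm.neg (.var a)

/-- The nested formula of a literal. -/
def litToNF {α : Type} : α × Bool → NF α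
  | (a, true) => .var a
  | (a, false) => .neg (.var a)

/-- Disjunction of a list of nested formulas (empty = ⊥). -/
def bigDisjNF {α : Type} : List (NF α) → NF α
  | [] => .bot
  | [A] => A
  | A :: L => .disj A (bigDisjNF L)

/-- Conjunction of a list of nested formulas (empty = ⊤). -/
def bigConjNF {α : Type} : List (NF α) → NF α
  | [] => .top
  | [A] => A
  | A :: L => .conj A (bigConjNF L)

namespace FClause

variable {α : Type}

/-- The propositional formula of a free clause. -/
def toProp (c : FClause α) : PropForm α :=
  .impl (bigConj (c.body.map litToProp)) (bigDisj (c.head.map litToProp))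

/-- A free clause as an augmented clause. -/
def toAug (c : FClause α) : AugClause α :=
  (bigDisjNF (c.head.map litToNF), bigConjNF (c.body.map litToNF))

/-- The atoms of a free clause. -/
def atomsF (c : FClause α) : Set α :=
  {a | (∃ b, (a, b) ∈ c.head) ∨ (∃ b, (a, b) ∈ c.body)}

/-- A general clause: all head literals are positive atoms. -/
def isGeneral (c : FClause α) : Prop := ∀ l ∈ c.head, l.2 = true

/-- A disjunctive clause: a general clause with nonempty head. -/
def isDisjunctive (c : FClause α) : Prop := c.isGeneral ∧ c.head ≠ []

/-- A constraint: a clause with empty head (head ⊥). -/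
def isConstraint (c : FClause α) : Prop := c.head = []

end FClause

/-- The theory of a free program. -/
def fTh {α : Type} (P : List (FClause α)) : Set (PropForm α) :=
  {F | ∃ c ∈ P, c.toProp = F}

/-- The signature of a free program. -/
def fSig {α : Type} (P : List (FClause α)) : Set α :=
  {a | ∃ c ∈ P, a ∈ c.atomsF}

/-- `GenDisj(P)`: each constraint `⊥ ← B` is replaced by `p ← B ∧ ¬p`,
where `p` is a new reserved atom. -/
def genDisj {α : Type} [DecidableEq α] (P : List (FClause α)) (p : α) :
    List (FClause α) :=
  P.map fun c =>
    if c.head = [] then ⟨[(p, true)], c.body ++ [(p, false)]⟩ else c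

/-- The atoms `a` such that `¬a` occurs in the head of some clause of `P`
(the set `S` of the FreeGen transformation), as a list. -/
def headNegs {α : Type} (P : List (FClause α)) : List α :=
  P.flatMap fun c => c.head.filterMap fun l => if l.2 = false then some l.1 else none

open scoped Classical in
/-- Replace the occurrence of `¬a` (for `a ∈ S`) by the positive atom `φ a`. -/
noncomputable def substLit {α : Type} (S : Set α) (φ : α → α) (l : α × Bool) :
    α × Bool :=
  if l.2 = false ∧ l.1 ∈ S then (φ l.1, true) else l

/-- Replace every occurrence of `¬a` (for `a ∈ S`) by `φ a` in a clause. -/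
noncomputable def FClause.subst {α : Type} (S : Set α) (φ : α → α) (c : FClause α) :
    FClause α :=
  ⟨c.head.map (substLit S φ), c.body.map (substLit S φ)⟩

/-- `Δ_S = ⋃_{a ∈ S} {φ(a) ← ¬a, ⊥ ← a ∧ φ(a)}`. -/
def deltaClauses {α : Type} (L : List α) (φ : α → α) : List (FClause α) :=
  L.flatMap fun a => [⟨[(φ a, true)], [(a, false)]⟩, ⟨[], [(a, true), (φ a, true)]⟩]

/-- `FreeGen(P) = P' ∪ Δ_S`. -/
noncomputable def freeGen {α : Type} (P : List (FClause α)) (φ : α → α) :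
    List (FClause α) :=
  P.map (FClause.subst {a | a ∈ headNegs P} φ) ++ deltaClauses (headNegs P) φ

open scoped Classical in
/-- The second reduction `redu2(P; ¬¬M)`: clauses whose body contains a literal
`¬a` with `a ∈ M` are deleted; in constraints, positive body literals `a ∈ M`
are deleted. -/
noncomputable def redu2 {α : Type} [DecidableEq α] (P : List (FClause α))
    (M : Set α) : List (FClause α) :=
  (P.filter fun c => decide (¬ ∃ l ∈ c.body, l.2 = false ∧ l.1 ∈ M)).map
    fun c =>
      if c.head = [] then
        ⟨[], c.body.filter fun l => decide (¬ (l.2 = true ∧ l.1 ∈ M))⟩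
      else c

/-- `P₂` is a conservative extension of `P₁`: `M₁` is an answer set of `P₁`
iff `M₂` is an answer set of `P₂`, where `M₁ = M₂ ∩ σ_{P₁}`. -/
def consExt {α : Type} (P1 P2 : List (AugClause α)) : Prop :=
  (∀ M2 : Set α, isAnswerSet P2 M2 → isAnswerSet P1 (M2 ∩ progSig P1)) ∧
  (∀ M1 : Set α, isAnswerSet P1 M1 →
    ∃ M2 : Set α, isAnswerSet P2 M2 ∧ M1 = M2 ∩ progSig P1)

/-- `P₂` is a strong conservative extension of the user program `P₁` (relative
to the user signature `U`): for every user program `P`, `P₂ ∪ P` is a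
conservative extension of `P₁ ∪ P`. -/
def strongConsExt {α : Type} (P1 P2 : List (AugClause α)) (U : Set α) : Prop :=
  ∀ P : List (AugClause α), progSig P ⊆ U → consExt (P1 ++ P) (P2 ++ P)

mutual
  /-- Negation normal form: push negations inward (no pending negation). -/
  def nnf0 {α : Type} : NF α → NF α
    | .var a => .var a
    | .top => .top
    | .bot => .bot
    | .conj A B => .conj (nnf0 A) (nnf0 B)
    | .disj A B => .disj (nnf0 A) (nnf0 B)
    | .neg A => nnf1 A
  /-- Negation normal form under one pending negation. -/
  def nnf1 {α : Type} : NF α → NF α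
    | .var a => .neg (.var a)
    | .top => .bot
    | .bot => .top
    | .conj A B => .disj (nnf1 A) (nnf1 B)
    | .disj A B => .conj (nnf1 A) (nnf1 B)
    | .neg A => nnf2 A
  /-- Negation normal form under two pending negations. -/
  def nnf2 {α : Type} : NF α → NF α
    | .var a => .neg (.neg (.var a))
    | .top => .top
    | .bot => .bot
    | .conj A B => .conj (nnf2 A) (nnf2 B)
    | .disj A B => .disj (nnf2 A) (nnf2 B)
    | .neg A => nnf1 A
end

/-- Conjunctive normal form (list of disjunction-lists of leaves). -/
def cnfNF {α : Type} : NF α → List (List (NF α))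
  | .conj A B => cnfNF A ++ cnfNF B
  | .disj A B => (cnfNF A).flatMap fun c => (cnfNF B).map fun d => c ++ d
  | F => [[F]]

/-- Disjunctive normal form (list of conjunction-lists of leaves). -/
def dnfNF {α : Type} : NF α → List (List (NF α))
  | .disj A B => dnfNF A ++ dnfNF B
  | .conj A B => (dnfNF A).flatMap fun c => (dnfNF B).map fun d => c ++ d
  | F => [[F]]

/-- Read a leaf as a literal (if it is one). -/
def leafLit {α : Type} : NF α → Option (α × Bool)
  | .var a => some (a, true)
  | .neg (.var a) => some (a, false)
  | _ => none

/-- Read a leaf `¬¬a` as the literal `¬a` to be moved to the other side. -/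
def dnegLit {α : Type} : NF α → Option (α × Bool)
  | .neg (.neg (.var a)) => some (a, false)
  | _ => none

/-- Build a free clause from a head disjunct-list and a body conjunct-list:
doubly negated atoms `¬¬a` in the head become `¬a` in the body and vice versa;
trivial clauses (⊤ in the head or ⊥ in the body) are removed. -/
def procClause {α : Type} [DecidableEq α] (hd bd : List (NF α)) :
    Option (FClause α) :=
  if NF.top ∈ hd ∨ NF.bot ∈ bd then none
  else some ⟨hd.filterMap leafLit ++ bd.filterMap dnegLit,
             bd.filterMap leafLit ++ hd.filterMap dnegLit⟩

/-- `AugFree(P)`: the free program obtained from the augmented program `P` by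
pushing negations inward, taking CNF of heads and DNF of bodies, splitting
conjunctions in heads and disjunctions in bodies into separate clauses, and
eliminating doubly negated atoms. -/
def augFree {α : Type} [DecidableEq α] (P : List (AugClause α)) :
    List (FClause α) :=
  P.flatMap fun c =>
    (cnfNF (nnf0 c.1)).flatMap fun hd =>
      (dnfNF (nnf0 c.2)).filterMap fun bd => procClause hd bd

/-- Positive formulas: no negation (in particular no ⊥) occurs. -/
def IsPositive {α : Type} : PropForm α → Prop
  | .var _ => True
  | .fals => False
  | .conj A B => IsPositive A ∧ IsPositive B
  | .disj A B => IsPositive A ∧ IsPositive B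
  | .impl A B => IsPositive A ∧ IsPositive B

/-- The set 𝐍 of two-negated formulas. -/
inductive IsTwoNeg {α : Type} : PropForm α → Prop
  | atom (a : α) : IsTwoNeg (neg (neg (var a)))
  | dneg {A} : IsTwoNeg A → IsTwoNeg (neg (neg A))
  | conj {A B} : IsTwoNeg A → IsTwoNeg B → IsTwoNeg (PropForm.conj A B)
  | disjL {A} (B) : IsTwoNeg A → IsTwoNeg (PropForm.disj A B)
  | disjR {A} (B) : IsTwoNeg A → IsTwoNeg (PropForm.disj B A)
  | himp {A} (B) : IsTwoNeg A → IsTwoNeg (PropForm.impl B A)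

/-- Satisfaction of a reduct only depends on the atoms of the formula. -/
theorem NF.satB_reduct_congr {α : Type} (M : Set α) {X Y : Set α} (F : NF α)
    (h : ∀ a ∈ F.atoms, a ∈ X ↔ a ∈ Y) :
    satB X (F.reduct M) ↔ satB Y (F.reduct M) := by
  induction F with
  | var a => exact h a rfl
  | top => exact Iff.rfl
  | bot => exact Iff.rfl
  | conj A B ihA ihB =>
    exact and_congr (ihA fun a ha => h a (Or.inl ha)) (ihB fun a ha => h a (Or.inr ha))
  | disj A B ihA ihB =>
    exact or_congr (ihA fun a ha => h a (Or.inl ha)) (ihB fun a ha => h a (Or.inr ha))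
  | neg A _ =>
    simp only [reduct]
    split_ifs <;> exact Iff.rfl

theorem satB_reduct_neg {α : Type} (N M : Set α) (F : NF α) :
    NF.satB N (F.neg.reduct M) ↔ ¬ NF.satB M (F.reduct M) := by
  simp only [NF.reduct]
  split_ifs with h <;> simp [NF.satB, h]

theorem satB_reduct_bigConjNF {α : Type} (N M : Set α) (L : List (NF α)) :
    NF.satB N ((bigConjNF L).reduct M) ↔ ∀ F ∈ L, NF.satB N (F.reduct M) := by
  induction L with
  | nil => simp [bigConjNF, NF.reduct, NF.satB]
  | cons A L ih =>
    cases L with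
    | nil => simp [bigConjNF]
    | cons B L => rw [List.forall_mem_cons, ← ih]; rfl

theorem mem_atoms_bigConjNF {α : Type} {a : α} {L : List (NF α)}
    (h : a ∈ (bigConjNF L).atoms) : ∃ F ∈ L, a ∈ F.atoms := by
  induction L with
  | nil => exact h.elim
  | cons A L ih =>
    cases L with
    | nil => exact ⟨A, List.mem_cons_self, h⟩
    | cons B L =>
      rcases h with h | h
      · exact ⟨A, List.mem_cons_self, h⟩
      · obtain ⟨F, hF, ha⟩ := ih h
        exact ⟨F, List.mem_cons_of_mem _ hF, ha⟩

theorem mem_atoms_bigDisjNF {α : Type} {a : α} {L : List (NF α)}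
    (h : a ∈ (bigDisjNF L).atoms) : ∃ F ∈ L, a ∈ F.atoms := by
  induction L with
  | nil => exact h.elim
  | cons A L ih =>
    cases L with
    | nil => exact ⟨A, List.mem_cons_self, h⟩
    | cons B L =>
      rcases h with h | h
      · exact ⟨A, List.mem_cons_self, h⟩
      · obtain ⟨F, hF, ha⟩ := ih h
        exact ⟨F, List.mem_cons_of_mem _ hF, ha⟩

theorem atoms_litToNF {α : Type} (l : α × Bool) : (litToNF l).atoms = {l.1} := by
  rcases l with ⟨a, _ | _⟩ <;> rfl

theorem FClause.toAug_atoms_subset {α : Type} (c : FClause α) :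
    c.toAug.1.atoms ∪ c.toAug.2.atoms ⊆ c.atomsF := by
  rintro a (h | h)
  · obtain ⟨F, hF, ha⟩ := mem_atoms_bigDisjNF h
    obtain ⟨l, hl, rfl⟩ := List.mem_map.1 hF
    rw [atoms_litToNF] at ha
    exact Or.inl ⟨l.2, by rwa [Set.mem_singleton_iff.1 ha]⟩
  · obtain ⟨F, hF, ha⟩ := mem_atoms_bigConjNF h
    obtain ⟨l, hl, rfl⟩ := List.mem_map.1 hF
    rw [atoms_litToNF] at ha
    exact Or.inr ⟨l.2, by rwa [Set.mem_singleton_iff.1 ha]⟩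

theorem progSig_map_toAug_subset {α : Type} (P : List (FClause α)) :
    progSig (P.map FClause.toAug) ⊆ fSig P := by
  rintro a ⟨_, hmem, ha⟩
  obtain ⟨c, hc, rfl⟩ := List.mem_map.1 hmem
  exact ⟨c, hc, c.toAug_atoms_subset ha⟩

theorem progSig_append {α : Type} (P Q : List (AugClause α)) :
    progSig (P ++ Q) = progSig P ∪ progSig Q := by
  ext a
  change (∃ c ∈ P ++ Q, _) ↔ (∃ c ∈ P, _) ∨ ∃ c ∈ Q, _
  simp only [List.mem_append, or_and_right, exists_or]

theorem closedUnder_progReduct {α : Type} (N M : Set α) (P : List (AugClause α)) :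
    closedUnder N (progReduct M P) ↔
      ∀ c ∈ P, NF.satB N (c.2.reduct M) → NF.satB N (c.1.reduct M) := by
  simp only [closedUnder, progReduct, List.forall_mem_map]

/-- Being closed under a reduct only depends on the atoms of the program. -/
theorem closedUnder_progReduct_congr {α : Type} (M : Set α) {X Y : Set α}
    (P : List (AugClause α)) (h : ∀ a ∈ progSig P, a ∈ X ↔ a ∈ Y) :
    closedUnder X (progReduct M P) ↔ closedUnder Y (progReduct M P) := by
  rw [closedUnder_progReduct, closedUnder_progReduct]
  refine forall₂_congr fun c hc => ?_
  rw [c.1.satB_reduct_congr M fun a ha => h a ⟨c, hc, Or.inl ha⟩,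
    c.2.satB_reduct_congr M fun a ha => h a ⟨c, hc, Or.inr ha⟩]

theorem isAnswerSet.subset_progSig {α : Type} {P : List (AugClause α)} {M : Set α}
    (h : isAnswerSet P M) : M ⊆ progSig P := by
  refine Set.inter_eq_left.1 (h.2 _ Set.inter_subset_left ?_)
  refine (closedUnder_progReduct_congr M P fun a ha => ?_).1 h.1
  simp [ha]

theorem closedUnder_progReduct_append {α : Type} (N M : Set α) (P Q : List (AugClause α)) :
    closedUnder N (progReduct M (P ++ Q)) ↔
      closedUnder N (progReduct M P) ∧ closedUnder N (progReduct M Q) := by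
  simp only [closedUnder_progReduct, List.forall_mem_append]

/-- The body of the clause replacing the constraint `⊥ ← B` in `GenDisj`. -/
theorem satB_reduct_body_append_neg {α : Type} (N M : Set α) (b : List (α × Bool)) (p : α) :
    NF.satB N ((bigConjNF ((b ++ [(p, false)]).map litToNF)).reduct M) ↔
      NF.satB N ((bigConjNF (b.map litToNF)).reduct M) ∧ p ∉ M := by
  rw [satB_reduct_bigConjNF, satB_reduct_bigConjNF, List.map_append, List.forall_mem_append]
  refine and_congr Iff.rfl ?_
  rw [List.map_singleton, List.forall_mem_singleton]
  exact satB_reduct_neg N M (.var p)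

theorem closedUnder_genDisj_iff {α : Type} [DecidableEq α] (P : List (FClause α)) {p : α}
    {N M : Set α} (hM : p ∉ M) (hN : p ∉ N) :
    closedUnder N (progReduct M ((genDisj P p).map FClause.toAug)) ↔
      closedUnder N (progReduct M (P.map FClause.toAug)) := by
  simp only [closedUnder_progReduct, genDisj, List.forall_mem_map]
  refine forall₂_congr fun c _ => ?_
  split_ifs with hc
  · simp only [FClause.toAug, satB_reduct_body_append_neg, hc]
    simp [bigDisjNF, litToNF, NF.reduct, NF.satB, hM, hN]
  · exact Iff.rfl

theorem isAnswerSet_genDisj_iff {α : Type} [DecidableEq α] (P : List (FClause α))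
    (Q : List (AugClause α)) {p : α} {M : Set α} (hM : p ∉ M) :
    isAnswerSet ((genDisj P p).map FClause.toAug ++ Q) M ↔
      isAnswerSet (P.map FClause.toAug ++ Q) M := by
  have key : ∀ N ⊆ M,
      (closedUnder N (progReduct M ((genDisj P p).map FClause.toAug ++ Q)) ↔
        closedUnder N (progReduct M (P.map FClause.toAug ++ Q))) := fun N hN => by
    rw [closedUnder_progReduct_append, closedUnder_progReduct_append,
      closedUnder_genDisj_iff P hM fun h => hM (hN h)]
  exact and_congr (key M subset_rfl) (forall₂_congr fun N hN => by rw [key N hN])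

/-- The only rules for `p` in `GenDisj(P)` are blocked by `¬p` as soon as `p` is true. -/
theorem notMem_of_isAnswerSet_genDisj {α : Type} [DecidableEq α] {P : List (FClause α)}
    {Q : List (AugClause α)} {p : α} {M : Set α} (hP : p ∉ fSig P) (hQ : p ∉ progSig Q)
    (h : isAnswerSet ((genDisj P p).map FClause.toAug ++ Q) M) : p ∉ M := by
  intro hpM
  suffices hcl : closedUnder (M \ {p})
      (progReduct M ((genDisj P p).map FClause.toAug ++ Q)) by
    have hpM' := hpM
    rw [← h.2 _ Set.sdiff_subset hcl] at hpM'
    exact hpM'.2 rfl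
  obtain ⟨hD, hQM⟩ := (closedUnder_progReduct_append _ _ _ _).1 h.1
  have hdiff : ∀ {S : Set α}, p ∉ S → ∀ a ∈ S, a ∈ M ↔ a ∈ M \ {p} := fun hS a ha =>
    ⟨fun haM => ⟨haM, fun hap => hS (Set.mem_singleton_iff.1 hap ▸ ha)⟩, fun haM => haM.1⟩
  refine (closedUnder_progReduct_append _ _ _ _).2
    ⟨?_, (closedUnder_progReduct_congr M Q (hdiff hQ)).1 hQM⟩
  simp only [closedUnder_progReduct, genDisj, List.forall_mem_map] at hD ⊢
  intro c hc
  have hDc := hD c hc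
  split_ifs at hDc ⊢ with hhead
  · exact fun hb => absurd hpM ((satB_reduct_body_append_neg _ _ _ _).1 hb).2
  · have hpc : p ∉ c.atomsF := fun hpc => hP ⟨c, hc, hpc⟩
    rwa [c.toAug.1.satB_reduct_congr M fun a ha =>
        hdiff hpc a (c.toAug_atoms_subset (Or.inl ha)),
      c.toAug.2.satB_reduct_congr M fun a ha =>
        hdiff hpc a (c.toAug_atoms_subset (Or.inr ha))] at hDc

/-- for a general user program `P`, `GenDisj(P)` is a strong
conservative extension of `P` (with `p` a reserved atom). -/
theorem genDisj_strong_conservative {α : Type} [DecidableEq α] (U : Set α)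
    (P : List (FClause α)) (hGen : ∀ c ∈ P, c.isGeneral) (hU : fSig P ⊆ U)
    (p : α) (hp : p ∉ U) :
    strongConsExt (P.map FClause.toAug) ((genDisj P p).map FClause.toAug) U := by
  intro Q hQ
  have hpP : p ∉ fSig P := fun h => hp (hU h)
  have hpQ : p ∉ progSig Q := fun h => hp (hQ h)
  refine ⟨fun M hM => ?_, fun M hM => ⟨M, ?_, ?_⟩⟩
  · have hM' := (isAnswerSet_genDisj_iff P Q (notMem_of_isAnswerSet_genDisj hpP hpQ hM)).1 hM
    rwa [Set.inter_eq_left.2 hM'.subset_progSig]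
  · refine (isAnswerSet_genDisj_iff P Q fun hpM => ?_).2 hM
    have hpS := hM.subset_progSig hpM
    rw [progSig_append] at hpS
    exact hpS.elim (fun h => hpP (progSig_map_toAug_subset P h)) hpQ
  · exact (Set.inter_eq_left.2 hM.subset_progSig).symm

end ASP
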